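/- arXiv:2105.04487 — 3 statements merged into one kernel-verified Lean document; each statement's English description precedes it below -/
import Mathlib

section
/- For the AMD code over F_q with encoder Enc(s) = (1/√q) Σ_{r∈F_q} |s, r, f(s,r)⟩ where f(s,r) = Σ_{i=1}^d s_i r^i + r^{d+2} and p ∤ d+2, and for any s' ≠ s ∈ F_q^d and any generalized Pauli error X^x Z^z, the transition probability satisfies |⟨ψ_{s'}| X^x Z^z |ψ_s⟩|^2 ≤ ((d+1)/q)^2. -/
open Finset

/-- The AMD authentication function `f(s, r) = Σ_{i=1}^d s_i r^i + r^{d+2}`. -/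
def amdFun {F : Type*} [Field F] (d : ℕ) (s : Fin d → F) (r : F) : F :=
  (∑ i : Fin d, s i * r ^ ((i : ℕ) + 1)) + r ^ (d + 2)

/-- The AMD codeword `|ψ_s⟩ = (1/√q) Σ_{r ∈ F_q} |s, r, f(s,r)⟩`, as a function on the
computational basis `(Fin d → F) × F × F`. -/
noncomputable def amdCodeword {F : Type*} [Field F] [Fintype F] [DecidableEq F]
    (d : ℕ) (s : Fin d → F) : (Fin d → F) × F × F → ℂ := fun g =>
  if g.1 = s ∧ g.2.2 = amdFun d s g.2.1 then
    ((1 / Real.sqrt (Fintype.card F) : ℝ) : ℂ) else 0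

/-- The `F`-valued pairing used in the phase of generalized Pauli `Z` operators. -/
def pauliDot {F : Type*} [Field F] {d : ℕ}
    (z g : (Fin d → F) × F × F) : F :=
  (∑ i : Fin d, z.1 i * g.1 i) + z.2.1 * g.2.1 + z.2.2 * g.2.2

/-- `X^x Z^z |ψ⟩`: the generalized Pauli tampering of a state `ψ`, where `e` is the
additive character `b ↦ ω^b` of `F` given by a primitive `q`-th root of unity `ω`. -/
noncomputable def pauliTampered {F : Type*} [Field F] {d : ℕ} (e : AddChar F ℂ)
    (x z : (Fin d → F) × F × F) (ψ : (Fin d → F) × F × F → ℂ) :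
    (Fin d → F) × F × F → ℂ := fun g =>
  e (pauliDot z (g - x)) * ψ (g - x)

open Polynomial in
/-- The message polynomial `Σ_{i=1}^d s_i X^i` composed with `X - a`. -/
noncomputable def amdMessagePoly {F : Type*} [Field F] (d : ℕ) (s : Fin d → F) (a : F) : F[X] :=
  ∑ i : Fin d, C (s i) * (X - C a) ^ ((i : ℕ) + 1)

open Polynomial in
/-- The polynomial in `r` whose roots are the solutions of `f(s', r) = f(s, r - a) + c`. -/
noncomputable def amdCollisionPoly {F : Type*} [Field F] (d : ℕ) (s s' : Fin d → F) (a c : F) :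
    F[X] :=
  (amdMessagePoly d s' 0 - amdMessagePoly d s a - C c) + (X ^ (d + 2) - (X - C a) ^ (d + 2))

lemma amdCollisionPoly_eval {F : Type*} [Field F] (d : ℕ) (s s' : Fin d → F) (a c r : F) :
    (amdCollisionPoly d s s' a c).eval r = amdFun d s' r - amdFun d s (r - a) - c := by
  simp only [amdCollisionPoly, amdMessagePoly, amdFun, Polynomial.eval_add, Polynomial.eval_sub,
    Polynomial.eval_finsetSum, Polynomial.eval_mul, Polynomial.eval_pow, Polynomial.eval_C,
    Polynomial.eval_X, sub_zero]
  ring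

lemma amdMessagePoly_natDegree_le {F : Type*} [Field F] (d : ℕ) (s : Fin d → F) (a : F) :
    (amdMessagePoly d s a).natDegree ≤ d := by
  refine Polynomial.natDegree_sum_le_of_forall_le _ _ fun i _ => ?_
  refine (Polynomial.natDegree_C_mul_le _ _).trans ?_
  rw [Polynomial.natDegree_pow, Polynomial.natDegree_X_sub_C]
  omega

lemma amdMessagePoly_zero_coeff {F : Type*} [Field F] (d : ℕ) (s : Fin d → F) (i : Fin d) :
    (amdMessagePoly d s 0).coeff ((i : ℕ) + 1) = s i := by
  simp [amdMessagePoly, Polynomial.coeff_X_pow, Fin.val_inj]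

open Polynomial in
/-- Above degree `d` only the pure powers contribute to the collision polynomial. -/
lemma amdCollisionPoly_coeff_of_lt {F : Type*} [Field F] (d : ℕ) (s s' : Fin d → F) (a c : F)
    {n : ℕ} (hn : d < n) :
    (amdCollisionPoly d s s' a c).coeff n =
      (if n = d + 2 then 1 else 0) - (-a) ^ (d + 2 - n) * ((d + 2).choose n : F) := by
  have h (t : Fin d → F) (b : F) : (amdMessagePoly d t b).coeff n = 0 :=
    coeff_eq_zero_of_natDegree_lt ((amdMessagePoly_natDegree_le d t b).trans_lt hn)
  rw [amdCollisionPoly, sub_eq_add_neg (X : F[X]), ← C_neg]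
  simp only [coeff_add, coeff_sub, h, coeff_X_pow, coeff_X_add_C_pow,
    coeff_C_of_ne_zero (by omega : n ≠ 0)]
  ring

lemma amdCollisionPoly_natDegree_le {F : Type*} [Field F] (d : ℕ) (s s' : Fin d → F) (a c : F) :
    (amdCollisionPoly d s s' a c).natDegree ≤ d + 1 := by
  rw [Polynomial.natDegree_le_iff_coeff_eq_zero]
  intro n hn
  rw [amdCollisionPoly_coeff_of_lt d s s' a c (by omega)]
  rcases eq_or_ne n (d + 2) with rfl | h
  · simp
  · simp [h, Nat.choose_eq_zero_of_lt (by omega : d + 2 < n)]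

lemma amdCollisionPoly_ne_zero {F : Type*} [Field F] (d : ℕ) (hd : ((d + 2 : ℕ) : F) ≠ 0)
    {s s' : Fin d → F} (hss' : s' ≠ s) (a c : F) : amdCollisionPoly d s s' a c ≠ 0 := by
  intro h0
  rcases eq_or_ne a 0 with rfl | ha
  · refine hss' (funext fun i => ?_)
    have h := congrArg (fun P => Polynomial.coeff P ((i : ℕ) + 1)) h0
    simpa [amdCollisionPoly, amdMessagePoly_zero_coeff, Polynomial.coeff_C, sub_eq_zero] using h
  · have h := amdCollisionPoly_coeff_of_lt d s s' a c (Nat.lt_succ_self d)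
    rw [h0, Nat.succ_eq_add_one, show d + 2 - (d + 1) = 1 by omega,
      show (d + 2).choose (d + 1) = d + 2 from Nat.choose_succ_self_right (d + 1)] at h
    have hmul : a * ((d + 2 : ℕ) : F) = 0 := by simpa using h
    exact mul_ne_zero ha hd hmul

/-- For distinct messages, a shift by `(a, c)` is accepted for at most `d + 1` values of `r`. -/
lemma card_amdFun_collision_le {F : Type*} [Field F] [Fintype F] [DecidableEq F] (d : ℕ)
    (hd : ((d + 2 : ℕ) : F) ≠ 0) {s s' : Fin d → F} (hss' : s' ≠ s) (a c : F) :
    #{r : F | amdFun d s' r - c = amdFun d s (r - a)} ≤ d + 1 := by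
  have hP := amdCollisionPoly_ne_zero d hd hss' a c
  refine le_trans (card_le_card fun r hr => ?_) <|
    (amdCollisionPoly d s s' a c).roots.toFinset_card_le.trans <|
      (Polynomial.card_roots' _).trans (amdCollisionPoly_natDegree_le d s s' a c)
  rw [Multiset.mem_toFinset, Polynomial.mem_roots hP, Polynomial.IsRoot, amdCollisionPoly_eval,
    sub_right_comm, (mem_filter.1 hr).2, sub_self]

/-- Each basis state contributes at most `1 / q` to the transition amplitude, and only when it lies
in the support of both the target codeword and the shifted source codeword. -/
lemma norm_amdCodeword_mul_pauliTampered_le {F : Type*} [Field F] [Fintype F] [DecidableEq F]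
    (d : ℕ) (e : AddChar F ℂ) (s s' : Fin d → F) (x z g : (Fin d → F) × F × F) :
    ‖(starRingEnd ℂ) (amdCodeword d s' g) * pauliTampered e x z (amdCodeword d s) g‖ ≤
      if (g.1 = s' ∧ g.2.2 = amdFun d s' g.2.1) ∧
        g.2.2 - x.2.2 = amdFun d s (g.2.1 - x.2.1) then 1 / (Fintype.card F : ℝ) else 0 := by
  rw [norm_mul, RCLike.norm_conj, pauliTampered, norm_mul, AddChar.norm_apply, one_mul]
  by_cases h1 : g.1 = s' ∧ g.2.2 = amdFun d s' g.2.1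
  · by_cases h2 : g.2.2 - x.2.2 = amdFun d s (g.2.1 - x.2.1)
    · have hbound (t : Fin d → F) (k : (Fin d → F) × F × F) :
          ‖amdCodeword d t k‖ ≤ 1 / √(Fintype.card F : ℝ) := by
        unfold amdCodeword
        split_ifs
        · rw [Complex.norm_real, Real.norm_of_nonneg (by positivity)]
        · rw [norm_zero]
          positivity
      rw [if_pos ⟨h1, h2⟩]
      calc _ ≤ 1 / √(Fintype.card F : ℝ) * (1 / √(Fintype.card F : ℝ)) :=
            mul_le_mul (hbound _ _) (hbound _ _) (norm_nonneg _) (by positivity)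
        _ = 1 / (Fintype.card F : ℝ) := by
            rw [div_mul_div_comm, one_mul, Real.mul_self_sqrt (Nat.cast_nonneg _)]
    · rw [if_neg fun h => h2 h.2]
      simp [amdCodeword, h2]
  · rw [if_neg fun h => h1 h.1]
    simp [amdCodeword, h1]

theorem quantum_amd_transition_bound (F : Type*) [Field F] [Fintype F] [DecidableEq F]
    (p : ℕ) [Fact p.Prime] [CharP F p] (d : ℕ) (hpd : ¬ p ∣ (d + 2))
    (e : AddChar F ℂ) (he : e.IsPrimitive)
    (s s' : Fin d → F) (hss' : s' ≠ s) (x z : (Fin d → F) × F × F) :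
    ‖∑ g : (Fin d → F) × F × F,
        (starRingEnd ℂ) (amdCodeword d s' g) *
          pauliTampered e x z (amdCodeword d s) g‖ ^ 2 ≤
      ((d + 1 : ℝ) / Fintype.card F) ^ 2 := by
  have hd : ((d + 2 : ℕ) : F) ≠ 0 := fun h => hpd ((CharP.cast_eq_zero_iff F p _).1 h)
  refine pow_le_pow_left₀ (norm_nonneg _) ?_ 2
  refine (norm_sum_le_of_le _ fun g _ =>
    norm_amdCodeword_mul_pauliTampered_le d e s s' x z g).trans ?_
  rw [← sum_filter, sum_const, nsmul_eq_mul, mul_one_div]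
  gcongr
  have hcard : #{g : (Fin d → F) × F × F | (g.1 = s' ∧ g.2.2 = amdFun d s' g.2.1) ∧
      g.2.2 - x.2.2 = amdFun d s (g.2.1 - x.2.1)} ≤ d + 1 := by
    refine (card_le_card_of_injOn (fun g => g.2.1) ?_ ?_).trans
      (card_amdFun_collision_le d hd hss' x.2.1 x.2.2)
    · intro g hg
      obtain ⟨⟨-, hg1⟩, hg2⟩ := (mem_filter.1 hg).2
      exact mem_coe.2 (mem_filter.2 ⟨mem_univ _, hg1 ▸ hg2⟩)
    · intro g hg k hk hgk
      obtain ⟨⟨hg1, hg2⟩, -⟩ := (mem_filter.1 hg).2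
      obtain ⟨⟨hk1, hk2⟩, -⟩ := (mem_filter.1 hk).2
      have hr : g.2.1 = k.2.1 := hgk
      exact Prod.ext (hg1.trans hk1.symm) (Prod.ext hr (by rw [hg2, hk2, hr]))
  exact_mod_cast hcard
end

section
/- For Haar-random orthonormal vectors: if V is a Haar-random isometry from C^K to C^N with columns |ψ_i⟩, and U is a fixed N×N unitary, then for j ≠ s, E[|⟨ψ_j|U|ψ_s⟩|^2] = (N^2 − |Tr(U)|^2) / (N(N^2−1)), which is at most 2/N for N ≥ 2. -/
open MeasureTheory Matrix

section InvariantTensor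

variable {n : Type*} [Fintype n] [DecidableEq n]

/-- Invariance of a tensor under the representation `conj g ⊗ g ⊗ g ⊗ conj g` of the unitary
group. -/
def IsUnitaryInvariant (T : n → n → n → n → ℂ) : Prop :=
  ∀ g ∈ unitaryGroup n ℂ, ∀ a b c d, T a b c d = ∑ k, ∑ l, ∑ m, ∑ o,
    star (g a k) * g b l * g c m * star (g d o) * T k l m o

lemma permMatrix_mem_unitaryGroup (σ : Equiv.Perm n) :
    σ.permMatrix ℂ ∈ unitaryGroup n ℂ := by
  rw [mem_unitaryGroup_iff, star_eq_conjTranspose, conjTranspose_permMatrix, ← permMatrix_mul]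
  simp

lemma diagonal_mem_unitaryGroup {z : n → ℂ} (hz : ∀ i, z i * star (z i) = 1) :
    diagonal z ∈ unitaryGroup n ℂ := by
  rw [mem_unitaryGroup_iff, star_eq_conjTranspose, diagonal_conjTranspose, diagonal_mul_diagonal,
    ← diagonal_one]
  exact congrArg diagonal (funext hz)

/-- There is a unitary matrix mixing two given basis vectors with coefficients `3/5` and `-4/5`. -/
lemma exists_unitary_row_eq {p q : n} (hpq : p ≠ q) :
    ∃ g ∈ unitaryGroup n ℂ,
      ∀ k, g p k = (if p = k then 3 / 5 else 0) + (if q = k then -4 / 5 else 0) := by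
  set w : n → ℂ := Pi.single p 1 + Pi.single q 2 with hw
  have hww : w ⬝ᵥ w = 5 := by
    simp [hw, hpq, hpq.symm]; norm_num
  have hstar : star w = w := by
    ext i; by_cases h : i = p <;> by_cases h' : i = q <;>
      simp_all
  refine ⟨1 - (2 / 5 : ℂ) • vecMulVec w w, ?_, fun k => ?_⟩
  · have h : star (1 - (2 / 5 : ℂ) • vecMulVec w w) = 1 - (2 / 5 : ℂ) • vecMulVec w w := by
      simp [star_eq_conjTranspose, conjTranspose_vecMulVec, hstar]
    rw [mem_unitaryGroup_iff, h]
    simp only [sub_mul, mul_sub, one_mul, mul_one, smul_mul_assoc, mul_smul_comm,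
      vecMulVec_mul_vecMulVec, hww, smul_smul, vecMulVec_smul]
    module
  · rcases eq_or_ne p k with rfl | hk
    · simp [hw, vecMulVec_apply, hpq, hpq.symm]; norm_num
    · rcases eq_or_ne q k with rfl | hk'
      · simp [hw, vecMulVec_apply, hpq, hpq.symm]; norm_num
      · simp [hw, vecMulVec_apply, hk, hk', hk.symm, hk'.symm]

namespace IsUnitaryInvariant

variable {T : n → n → n → n → ℂ}

lemma perm (hT : IsUnitaryInvariant T) (σ : Equiv.Perm n) (a b c d : n) :
    T (σ a) (σ b) (σ c) (σ d) = T a b c d := by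
  rw [hT _ (permMatrix_mem_unitaryGroup σ) a b c d]
  simp [Equiv.Perm.permMatrix, PEquiv.toMatrix_apply, apply_ite]

lemma phase (hT : IsUnitaryInvariant T) {z : n → ℂ} (hz : ∀ i, z i * star (z i) = 1)
    (a b c d : n) :
    T a b c d = star (z a) * z b * z c * star (z d) * T a b c d := by
  conv_lhs => rw [hT _ (diagonal_mem_unitaryGroup hz) a b c d]
  simp [diagonal_apply, apply_ite]

lemma eq_zero_of_phase_ne_one (hT : IsUnitaryInvariant T) {a b c d : n} (i : n)
    (h : star (Function.update (1 : n → ℂ) i Complex.I a) *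
      Function.update (1 : n → ℂ) i Complex.I b * Function.update (1 : n → ℂ) i Complex.I c *
      star (Function.update (1 : n → ℂ) i Complex.I d) ≠ 1) :
    T a b c d = 0 := by
  have hz : ∀ j, Function.update (1 : n → ℂ) i Complex.I j *
      star (Function.update (1 : n → ℂ) i Complex.I j) = 1 := by
    intro j
    rcases eq_or_ne j i with rfl | hj <;> simp [*]
  by_contra h0
  exact h (mul_right_cancel₀ h0 ((hT.phase hz a b c d).symm.trans (one_mul _).symm))

lemma eq_zero (hT : IsUnitaryInvariant T) {a b c d : n} (h₁ : ¬(a = b ∧ c = d))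
    (h₂ : ¬(a = c ∧ b = d)) :
    T a b c d = 0 := by
  have hI : -Complex.I ≠ 1 := fun h => by simpa using congrArg Complex.re h
  have hI' : Complex.I ≠ 1 := fun h => by simpa using congrArg Complex.re h
  have hn : (-1 : ℂ) ≠ 1 := by norm_num
  rcases eq_or_ne a b with rfl | hab
  · have hcd : c ≠ d := fun h => h₁ ⟨rfl, h⟩
    apply hT.eq_zero_of_phase_ne_one c
    rcases eq_or_ne a c with rfl | hac <;> simp [*, hcd.symm]
  · rcases eq_or_ne a c with rfl | hac
    · have hbd : b ≠ d := fun h => h₂ ⟨rfl, h⟩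
      apply hT.eq_zero_of_phase_ne_one b
      simp [*, hbd.symm]
    · apply hT.eq_zero_of_phase_ne_one a
      rcases eq_or_ne d a with rfl | had <;> simp [*, hab.symm, hac.symm]

lemma diag_eq (hT : IsUnitaryInvariant T) {p q : n} (hpq : p ≠ q) :
    T p p p p = T p p q q + T p q p q := by
  obtain ⟨g, hg, hrow⟩ := exists_unitary_row_eq hpq
  have key := hT g hg p p p p
  have hσ := hT.perm (Equiv.swap p q)
  have h₁ : T q q q q = T p p p p := by simpa using hσ p p p p
  have h₂ : T q q p p = T p p q q := by simpa [hpq] using hσ p p q q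
  have h₃ : T q p q p = T p q p q := by simpa [hpq] using hσ p q p q
  have hz : ∀ {a b c d : n}, ¬(a = b ∧ c = d) → ¬(a = c ∧ b = d) → T a b c d = 0 := hT.eq_zero
  simp only [hrow, star_add, apply_ite star, star_zero, add_mul, mul_add, Finset.sum_add_distrib,
    ite_mul, mul_ite, zero_mul, mul_zero, Finset.sum_ite_eq, Finset.mem_univ, if_true] at key
  simp (disch := simp [hpq, hpq.symm]) only [h₁, h₂, h₃, hz] at key
  norm_num at key
  linear_combination (625 / 288 : ℂ) * key

lemma eq_add (hT : IsUnitaryInvariant T) {p q : n} (hpq : p ≠ q) (a b c d : n) :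
    T a b c d = (if a = b ∧ c = d then T p p q q else 0) +
      (if a = c ∧ b = d then T p q p q else 0) := by
  have hperm : ∀ {x y : n}, x ≠ y → ∃ σ : Equiv.Perm n, σ p = x ∧ σ q = y := by
    intro x y hxy
    refine ⟨Equiv.swap (Equiv.swap p x q) y * Equiv.swap p x, ?_, by simp⟩
    have hx : x ≠ Equiv.swap p x q := by
      intro h
      apply hpq
      apply (Equiv.swap p x).injective
      simpa using h
    simp [Equiv.swap_apply_of_ne_of_ne hx hxy]
  by_cases h₁ : a = b ∧ c = d
  · obtain ⟨rfl, rfl⟩ := h₁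
    rcases eq_or_ne a c with rfl | hac
    · obtain ⟨r, hr⟩ : ∃ r, a ≠ r := by
        rcases eq_or_ne a p with rfl | h
        exacts [⟨q, hpq⟩, ⟨p, h⟩]
      obtain ⟨σ, rfl, rfl⟩ := hperm hr
      simp [hT.diag_eq hr, hT.perm σ]
    · obtain ⟨σ, rfl, rfl⟩ := hperm hac
      simp [hpq, hT.perm σ]
  · by_cases h₂ : a = c ∧ b = d
    · obtain ⟨rfl, rfl⟩ := h₂
      have hab : a ≠ b := fun h => h₁ ⟨h, h⟩
      obtain ⟨σ, rfl, rfl⟩ := hperm hab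
      simp [hpq, hT.perm σ]
    · simp [h₁, h₂, hT.eq_zero h₁ h₂]

end IsUnitaryInvariant

end InvariantTensor

section Haar

variable {n : Type*}

/-- The fourth-order monomial `conj (U a j) * U b s * U c j * conj (U d s)` in the entries of the
columns `j` and `s` of a matrix `U`. -/
def columnMonomial (j s : n) (U : Matrix n n ℂ) (a b c d : n) : ℂ :=
  star (U a j) * U b s * U c j * star (U d s)

variable [Fintype n]

lemma columnMonomial_mul (j s : n) (g U : Matrix n n ℂ) (a b c d : n) :
    columnMonomial j s (g * U) a b c d = ∑ k, ∑ l, ∑ m, ∑ o,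
      star (g a k) * g b l * g c m * star (g d o) * columnMonomial j s U k l m o := by
  calc columnMonomial j s (g * U) a b c d
      = (∑ k, star (g a k) * star (U k j)) * (∑ l, g b l * U l s) * (∑ m, g c m * U m j) *
          ∑ o, star (g d o) * star (U o s) := by
        simp only [columnMonomial, mul_apply, star_sum, star_mul']
    _ = ∑ k, ∑ l, ∑ m, ∑ o, (star (g a k) * star (U k j)) * (g b l * U l s) * (g c m * U m j) *
          (star (g d o) * star (U o s)) := by
        simp only [← Finset.mul_sum, ← Finset.sum_mul]
    _ = _ := by
        refine Finset.sum_congr rfl fun k _ => Finset.sum_congr rfl fun l _ =>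
          Finset.sum_congr rfl fun m _ => Finset.sum_congr rfl fun o _ => ?_
        rw [columnMonomial]; ring

lemma normSq_sum_eq_sum_columnMonomial (j s : n) (A U : Matrix n n ℂ) :
    ((‖∑ k, ∑ l, star (U k j) * A k l * U l s‖ ^ 2 : ℝ) : ℂ) =
      ∑ k, ∑ l, ∑ m, ∑ o, A k l * star (A m o) * columnMonomial j s U k l m o := by
  push_cast
  rw [← Complex.mul_conj', starRingEnd_apply]
  simp only [star_sum, star_mul', star_star, Finset.sum_mul]
  simp only [Finset.mul_sum]
  refine Finset.sum_congr rfl fun k _ => Finset.sum_congr rfl fun l _ =>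
    Finset.sum_congr rfl fun m _ => Finset.sum_congr rfl fun o _ => ?_
  rw [columnMonomial]; ring

variable [DecidableEq n]

lemma sum_columnMonomial_inner {j s : n} (hjs : j ≠ s) {U : Matrix n n ℂ}
    (hU : U ∈ unitaryGroup n ℂ) : ∑ a, ∑ c, columnMonomial j s U a a c c = 0 := by
  have h : ∑ a, star (U a j) * U a s = 0 := by
    simpa [mul_apply, star_apply, one_apply, hjs] using
      congrFun (congrFun (mem_unitaryGroup_iff'.mp hU) j) s
  simp_rw [columnMonomial, mul_assoc (star _ * _), ← Finset.mul_sum, ← Finset.sum_mul, h, zero_mul]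

lemma sum_columnMonomial_norm (j s : n) {U : Matrix n n ℂ}
    (hU : U ∈ unitaryGroup n ℂ) : ∑ a, ∑ b, columnMonomial j s U a b a b = 1 := by
  have h (i : n) : ∑ a, star (U a i) * U a i = 1 := by
    simpa [mul_apply, star_apply, one_apply] using
      congrFun (congrFun (mem_unitaryGroup_iff'.mp hU) i) i
  calc _ = ∑ a, ∑ b, (star (U a j) * U a j) * (star (U b s) * U b s) := by
        refine Finset.sum_congr rfl fun a _ => Finset.sum_congr rfl fun b _ => ?_
        rw [columnMonomial]; ring
    _ = 1 := by rw [← Finset.sum_mul_sum, h, h, one_mul]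

variable [MeasurableSpace (unitaryGroup n ℂ)] [BorelSpace (unitaryGroup n ℂ)]
  (μ : Measure (unitaryGroup n ℂ))

lemma integrable_columnMonomial [IsFiniteMeasure μ] (j s a b c d : n) :
    Integrable (fun U : unitaryGroup n ℂ => columnMonomial j s (U : Matrix n n ℂ) a b c d) μ := by
  have hc : Continuous
      fun U : unitaryGroup n ℂ => columnMonomial j s (U : Matrix n n ℂ) a b c d := by
    unfold columnMonomial
    have h (x y : n) : Continuous fun U : unitaryGroup n ℂ => (U : Matrix n n ℂ) x y :=
      continuous_subtype_val.matrix_elem x y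
    exact (((h a j).star.mul (h b s)).mul (h c j)).mul (h d s).star
  refine Integrable.of_bound hc.aestronglyMeasurable 1 (.of_forall fun U => ?_)
  have h := entry_norm_bound_of_unitary U.2
  simp only [columnMonomial, norm_mul, norm_star]
  have := h a j
  have := h b s
  have := h c j
  have := h d s
  calc _ ≤ (1 * 1 * 1 * 1 : ℝ) := by gcongr
    _ = 1 := by norm_num

lemma integral_sum_columnMonomial [IsFiniteMeasure μ] (j s : n) (x : n → n → n → n → ℂ) :
    ∫ U : unitaryGroup n ℂ,
        ∑ k, ∑ l, ∑ m, ∑ o, x k l m o * columnMonomial j s (U : Matrix n n ℂ) k l m o ∂μ =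
      ∑ k, ∑ l, ∑ m, ∑ o,
        x k l m o * ∫ U, columnMonomial j s (U : Matrix n n ℂ) k l m o ∂μ := by
  have hi (k l m o : n) := (integrable_columnMonomial μ j s k l m o).const_mul (x k l m o)
  have hi₁ (k l m : n) := integrable_finsetSum Finset.univ fun o _ => hi k l m o
  have hi₂ (k l : n) := integrable_finsetSum Finset.univ fun m _ => hi₁ k l m
  have hi₃ (k : n) := integrable_finsetSum Finset.univ fun l _ => hi₂ k l
  rw [integral_finsetSum _ fun k _ => hi₃ k]
  refine Finset.sum_congr rfl fun k _ => ?_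
  rw [integral_finsetSum _ fun l _ => hi₂ k l]
  refine Finset.sum_congr rfl fun l _ => ?_
  rw [integral_finsetSum _ fun m _ => hi₁ k l m]
  refine Finset.sum_congr rfl fun m _ => ?_
  rw [integral_finsetSum _ fun o _ => hi k l m o]
  exact Finset.sum_congr rfl fun o _ => integral_const_mul _ _

lemma isUnitaryInvariant_integral_columnMonomial [IsFiniteMeasure μ] [μ.IsMulLeftInvariant]
    (j s : n) :
    IsUnitaryInvariant fun a b c d => ∫ U, columnMonomial j s (U : Matrix n n ℂ) a b c d ∂μ := by
  intro g hg a b c d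
  have hi := integrable_columnMonomial μ j s
  have h := integral_mul_left_eq_self (μ := μ)
    (fun U : unitaryGroup n ℂ => columnMonomial j s (U : Matrix n n ℂ) a b c d) ⟨g, hg⟩
  beta_reduce
  rw [← h]
  simp only [UnitaryGroup.mul_val, columnMonomial_mul]
  exact integral_sum_columnMonomial μ j s fun k l m o =>
    star (g a k) * g b l * g c m * star (g d o)

end Haar

theorem haar_second_moment_offdiag (N : ℕ) (hN : 2 ≤ N)
    [MeasurableSpace (Matrix.unitaryGroup (Fin N) ℂ)]
    [BorelSpace (Matrix.unitaryGroup (Fin N) ℂ)]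
    (μ : Measure (Matrix.unitaryGroup (Fin N) ℂ))
    [μ.IsHaarMeasure] [IsProbabilityMeasure μ]
    (A : Matrix (Fin N) (Fin N) ℂ) (hA : A ∈ Matrix.unitaryGroup (Fin N) ℂ)
    (j s : Fin N) (hjs : j ≠ s) :
    (∫ U : Matrix.unitaryGroup (Fin N) ℂ,
        ‖∑ k : Fin N, ∑ l : Fin N,
          (starRingEnd ℂ) ((U : Matrix (Fin N) (Fin N) ℂ) k j) * A k l *
            (U : Matrix (Fin N) (Fin N) ℂ) l s‖ ^ 2 ∂μ) =
      ((N : ℝ) ^ 2 - ‖A.trace‖ ^ 2) / (N * ((N : ℝ) ^ 2 - 1)) ∧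
    ((N : ℝ) ^ 2 - ‖A.trace‖ ^ 2) / (N * ((N : ℝ) ^ 2 - 1)) ≤ 2 / N := by
  have hN' : (2 : ℝ) ≤ N := by exact_mod_cast hN
  have hpos : (0 : ℝ) < (N : ℝ) ^ 2 - 1 := by nlinarith
  constructor
  · set T : Fin N → Fin N → Fin N → Fin N → ℂ :=
      fun a b c d => ∫ U, columnMonomial j s (U : Matrix (Fin N) (Fin N) ℂ) a b c d ∂μ with hTdef
    have hi := integrable_columnMonomial μ j s
    have hT := (isUnitaryInvariant_integral_columnMonomial μ j s).eq_add hjs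
    change ∀ a b c d, T a b c d = _ at hT
    generalize (∫ U, columnMonomial j s (U : Matrix (Fin N) (Fin N) ℂ) j j s s ∂μ) = α at hT
    generalize (∫ U, columnMonomial j s (U : Matrix (Fin N) (Fin N) ℂ) j s j s ∂μ) = β at hT
    have h₀ : ∑ a, ∑ c, T a a c c = 0 := by
      simp_rw [hTdef, ← integral_finsetSum Finset.univ fun c _ => hi _ _ c c]
      rw [← integral_finsetSum _ fun a _ => integrable_finsetSum _ fun c _ => hi a a c c]
      simp [sum_columnMonomial_inner hjs (Subtype.prop _)]
    have h₁ : ∑ a, ∑ b, T a b a b = 1 := by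
      simp_rw [hTdef, ← integral_finsetSum Finset.univ fun b _ => hi _ b _ b]
      rw [← integral_finsetSum _ fun a _ => integrable_finsetSum _ fun b _ => hi a b a b]
      simp [sum_columnMonomial_norm j s (Subtype.prop _)]
    have h₂ : ∑ k, ∑ l, A k l * star (A k l) = N := by
      simpa [trace, mul_apply, star_apply] using congrArg trace (mem_unitaryGroup_iff.mp hA)
    have h₃ : ((‖A.trace‖ ^ 2 : ℝ) : ℂ) = ∑ k, ∑ m, A k k * star (A m m) := by
      push_cast
      rw [← Complex.mul_conj', starRingEnd_apply, trace, star_sum, Finset.sum_mul_sum]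
      rfl
    have h₄ := integral_sum_columnMonomial μ j s fun k l m o => A k l * star (A m o)
    simp_rw [← normSq_sum_eq_sum_columnMonomial] at h₄
    rw [integral_complex_ofReal] at h₄
    change _ = ∑ k, ∑ l, ∑ m, ∑ o, A k l * star (A m o) * T k l m o at h₄
    have h₅ : ∑ k, ∑ l, ∑ m, ∑ o, A k l * star (A m o) * T k l m o =
        α * ((‖A.trace‖ ^ 2 : ℝ) : ℂ) + β * N := by
      rw [← h₂, h₃, mul_comm α, mul_comm β]
      simp only [hT, mul_add, Finset.sum_add_distrib, mul_ite, mul_zero, ite_and,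
        Finset.sum_ite_irrel, Finset.sum_const_zero, Finset.sum_ite_eq, Finset.mem_univ, if_true,
        Finset.sum_mul]
    have hα : (N : ℂ) * (N * α + β) = 0 := by
      simpa [hT, Finset.sum_add_distrib, mul_add] using h₀
    have hβ : (N : ℂ) * (α + N * β) = 1 := by
      simpa [hT, Finset.sum_add_distrib, mul_add] using h₁
    have hN₀ : (N : ℂ) ≠ 0 := by exact_mod_cast (by omega : N ≠ 0)
    have hN₁ : (N : ℂ) ^ 2 - 1 ≠ 0 := by exact_mod_cast hpos.ne'
    have hα' : N * α + β = 0 := (mul_eq_zero.mp hα).resolve_left hN₀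
    apply Complex.ofReal_injective
    simp only [starRingEnd_apply]
    refine (h₄.trans h₅).trans ?_
    push_cast
    rw [eq_div_iff (mul_ne_zero hN₀ hN₁)]
    have h₆ : α * (N * ((N : ℂ) ^ 2 - 1)) = -1 := by
      linear_combination (N : ℂ) ^ 2 * hα' - hβ
    linear_combination ((‖A.trace‖ : ℂ) ^ 2 - (N : ℂ) ^ 2) * h₆ +
      (N : ℂ) ^ 2 * ((N : ℂ) ^ 2 - 1) * hα'
  · rw [div_le_div_iff₀ (by positivity) (by positivity)]
    nlinarith [sq_nonneg ‖A.trace‖, mul_pos (show (0 : ℝ) < N by linarith) hpos]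
end

section
/- For all t ≥ 1 and N ≥ t, the sum over all permutations σ ∈ S_t of the Weingarten function satisfies Σ_{σ∈S_t} Wg(σ, N) = 1/(N(N+1)···(N+t−1)). -/
open MeasureTheory Matrix

/-- The unitary Weingarten function
`Wg(σ, N) = ∫_{U(N)} U_{11} ⋯ U_{tt} conj(U_{1σ(1)}) ⋯ conj(U_{tσ(t)}) dU`,
where `μ` is the (normalized) Haar measure on the unitary group `U(N)` and
`{1, ..., t}` is embedded into `{1, ..., N}` via `ht : t ≤ N`. -/
noncomputable def weingarten (N t : ℕ) (ht : t ≤ N)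
    [MeasurableSpace (Matrix.unitaryGroup (Fin N) ℂ)]
    (μ : Measure (Matrix.unitaryGroup (Fin N) ℂ)) (σ : Equiv.Perm (Fin t)) : ℂ :=
  ∫ U : Matrix.unitaryGroup (Fin N) ℂ,
    (∏ i : Fin t, (U : Matrix (Fin N) (Fin N) ℂ) (Fin.castLE ht i) (Fin.castLE ht i)) *
      ∏ i : Fin t,
        (starRingEnd ℂ)
          ((U : Matrix (Fin N) (Fin N) ℂ) (Fin.castLE ht i) (Fin.castLE ht (σ i))) ∂μ

open scoped Nat

section Content

variable {N t : ℕ}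

/-- The number of occurrences of each index in a tuple of indices. -/
noncomputable def content (j : Fin t → Fin N) : Fin N →₀ ℕ :=
  ∑ i, Finsupp.single (j i) 1

lemma content_apply (j : Fin t → Fin N) (a : Fin N) :
    content j a = Fintype.card {i // j i = a} := by
  simp [content, Finsupp.finsetSum_apply, Finsupp.single_apply, Fintype.card_subtype]

lemma content_apply_le (j : Fin t → Fin N) (a : Fin N) : content j a ≤ t := by
  simpa [content_apply] using Fintype.card_subtype_le (fun i => j i = a)

lemma content_cons (a : Fin N) (j : Fin t → Fin N) :
    content (Fin.cons a j : Fin (t + 1) → Fin N) = Finsupp.single a 1 + content j := by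
  simp [content, Fin.sum_univ_succ]

lemma content_comp_perm (j : Fin t → Fin N) (σ : Equiv.Perm (Fin t)) :
    content (j ∘ σ) = content j :=
  Equiv.sum_comp σ fun i => Finsupp.single (j i) 1

lemma exists_perm_of_content_eq {j k : Fin t → Fin N} (h : content j = content k) :
    ∃ τ : Equiv.Perm (Fin t), j ∘ τ = k := by
  have e : ∀ a, Nonempty ({i // k i = a} ≃ {i // j i = a}) := fun a => by
    rw [← Fintype.card_eq, ← content_apply, ← content_apply, h]
  exact ⟨Equiv.ofFiberEquiv fun a => (e a).some, funext fun i => Equiv.ofFiberEquiv_map _ i⟩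

/-- The product of the factorials of the multiplicities in a tuple of indices. -/
noncomputable def contentFactorial (j : Fin t → Fin N) : ℕ := ∏ a, (content j a)!

lemma contentFactorial_cons (a : Fin N) (j : Fin t → Fin N) :
    contentFactorial (Fin.cons a j : Fin (t + 1) → Fin N) =
      (content j a + 1) * contentFactorial j := by
  rw [contentFactorial, contentFactorial, ← Finset.mul_prod_erase _ _ (Finset.mem_univ a),
    ← Finset.mul_prod_erase (s := Finset.univ) (fun a => (content j a)!) (Finset.mem_univ a),
    ← mul_assoc, content_cons]
  congr 1
  · simp [add_comm 1, Nat.factorial_succ]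
  · refine Finset.prod_congr rfl fun b hb => ?_
    simp [(Finset.ne_of_mem_erase hb).symm]

lemma sum_content_apply (j : Fin t → Fin N) : ∑ a, content j a = t := by
  simp only [content, Finsupp.finsetSum_apply]
  rw [Finset.sum_comm]
  simp [Finsupp.single_apply]

lemma sum_contentFactorial (N t : ℕ) :
    ∑ j : Fin t → Fin N, contentFactorial j = ∏ s ∈ Finset.range t, (N + s) := by
  induction t with
  | zero => simp [contentFactorial, content]
  | succ t ih =>
    rw [← (Fin.consEquiv fun _ => Fin N).sum_comp, Fintype.sum_prod_type_right]
    have h (j : Fin t → Fin N) : ∑ a, contentFactorial (Fin.consEquiv (fun _ => Fin N) (a, j)) =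
        contentFactorial j * (N + t) := by
      change ∑ a, contentFactorial (Fin.cons a j : Fin (t + 1) → Fin N) = _
      simp only [contentFactorial_cons]
      rw [← Finset.sum_mul, Finset.sum_add_distrib, sum_content_apply]
      simp [mul_comm, add_comm]
    rw [Finset.sum_congr rfl fun j _ => h j, ← Finset.sum_mul, ih, Finset.prod_range_succ]

lemma card_perm_comp_eq (j k : Fin t → Fin N) :
    Fintype.card {σ : Equiv.Perm (Fin t) // j ∘ σ = k} =
      if content k = content j then contentFactorial j else 0 := by
  split_ifs with h
  · obtain ⟨τ, rfl⟩ := exists_perm_of_content_eq h.symm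
    simp only [contentFactorial, content_apply]
    rw [← DomMulAct.stabilizer_card j]
    refine Fintype.card_congr ((Equiv.mulRight τ⁻¹).subtypeEquiv fun σ => ?_)
    constructor
    · intro hσ
      ext i
      simpa using congr_arg Fin.val (congr_fun hσ (τ⁻¹ i))
    · intro hσ
      ext i
      simpa using congr_arg Fin.val (congr_fun hσ (τ i))
  · rw [Fintype.card_eq_zero_iff]
    exact ⟨fun ⟨σ, hσ⟩ => h (hσ ▸ content_comp_perm j σ)⟩

lemma sum_perm_comp (j : Fin t → Fin N) (f : (Fin t → Fin N) → ℂ) :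
    ∑ σ : Equiv.Perm (Fin t), f (j ∘ σ) =
      contentFactorial j * ∑ k with content k = content j, f k := by
  rw [← Finset.sum_fiberwise _ fun σ : Equiv.Perm (Fin t) => j ∘ σ, Finset.mul_sum,
    Finset.sum_filter]
  refine Finset.sum_congr rfl fun k _ => ?_
  rw [Finset.sum_congr rfl (g := fun _ => f k) (by simp +contextual), Finset.sum_const,
    ← Fintype.card_subtype, card_perm_comp_eq]
  split_ifs <;> simp

lemma contentFactorial_of_injective {j : Fin t → Fin N} (hj : Function.Injective j) :
    contentFactorial j = 1 := by
  refine Finset.prod_eq_one fun a _ => Nat.factorial_eq_one.2 ?_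
  rw [content_apply, Fintype.card_le_one_iff]
  rintro ⟨x, rfl⟩ ⟨y, hy⟩
  exact Subtype.ext (hj hy.symm)

/-- Power sums over tuples separate contents. -/
lemma sum_content_fiber_eq_zero (b : (Fin t → Fin N) → ℂ)
    (h : ∀ x : Fin N → ℝ, ∑ j, b j * ∏ i, (x (j i) : ℂ) ^ 2 = 0) (α : Fin N →₀ ℕ) :
    ∑ j with content j = α, b j = 0 := by
  have hp : ∑ j, MvPolynomial.monomial (content j) (b j) = 0 := by
    refine MvPolynomial.funext_set (fun _ => (fun x : ℝ => (x : ℂ)) '' Set.Ici 0)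
      (fun _ => (Set.Ici_infinite 0).image Complex.ofReal_injective.injOn) fun y hy => ?_
    choose z hz hzy using fun a => hy a trivial
    have := h fun a => √(z a)
    simp only [← Complex.ofReal_pow, Real.sq_sqrt (hz _)] at this
    simp only [hzy] at this
    simp only [map_sum, map_zero, ← this]
    refine Finset.sum_congr rfl fun j _ => ?_
    simp only [MvPolynomial.eval_monomial, content]
    rw [← Finsupp.prod_finsetSum_index (by simp) (by simp [pow_add])]
    simp
  have := congr_arg (MvPolynomial.coeff α) hp
  simpa [MvPolynomial.coeff_sum, MvPolynomial.coeff_monomial, Finset.sum_filter] using this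

end Content

section Moments

variable {N t : ℕ}

/-- The monomial `∏ i, U (j i) (e i)` in the entries of `U`. -/
noncomputable def entryMonomial (e j : Fin t → Fin N) (U : Matrix.unitaryGroup (Fin N) ℂ) : ℂ :=
  ∏ i, (U : Matrix (Fin N) (Fin N) ℂ) (j i) (e i)

lemma continuous_entryMonomial (e j : Fin t → Fin N) : Continuous (entryMonomial e j) :=
  continuous_finsetProd _ fun i _ =>
    (continuous_subtype_val (p := (· ∈ Matrix.unitaryGroup (Fin N) ℂ))).matrix_elem (j i) (e i)

lemma norm_entryMonomial_le (e j : Fin t → Fin N) (U : Matrix.unitaryGroup (Fin N) ℂ) :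
    ‖entryMonomial e j U‖ ≤ 1 := by
  rw [entryMonomial, norm_prod]
  exact Finset.prod_le_one (fun _ _ => norm_nonneg _) fun i _ =>
    entry_norm_bound_of_unitary U.2 _ _

/-- Every unit vector with real entries is a row of a unitary matrix. -/
lemma exists_unitary_row_eq_s17 (a : Fin N) (y : Fin N → ℝ) (hy : ∑ b, y b ^ 2 = 1) :
    ∃ V : Matrix.unitaryGroup (Fin N) ℂ,
      ∀ b, (V : Matrix (Fin N) (Fin N) ℂ) a b = y b := by
  let v : EuclideanSpace ℂ (Fin N) := WithLp.toLp 2 fun b => (y b : ℂ)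
  have hv : ‖v‖ = 1 := by
    simp [EuclideanSpace.norm_eq, v, hy]
  obtain ⟨b, hb⟩ := Orthonormal.exists_orthonormalBasis_extension_of_card_eq (𝕜 := ℂ)
    (E := EuclideanSpace ℂ (Fin N)) (ι := Fin N) (by simp) (v := fun _ => v) (s := {a})
    ⟨fun _ => hv, fun i j hij => (hij (Subsingleton.elim i j)).elim⟩
  have hM := (EuclideanSpace.basisFun (Fin N) ℂ).toMatrix_orthonormalBasis_mem_unitary b
  refine ⟨⟨_, Matrix.transpose_mem_unitaryGroup_iff.2 hM⟩, fun c => ?_⟩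
  simp [Module.Basis.toMatrix_apply, hb a rfl, v]

variable [MeasurableSpace (Matrix.unitaryGroup (Fin N) ℂ)]

/-- The joint moment of two monomials in the entries of a random unitary matrix. -/
noncomputable def entryMoment (μ : Measure (Matrix.unitaryGroup (Fin N) ℂ))
    (e j k : Fin t → Fin N) : ℂ :=
  ∫ U, entryMonomial e j U * (starRingEnd ℂ) (entryMonomial e k U) ∂μ

variable [BorelSpace (Matrix.unitaryGroup (Fin N) ℂ)]
  (μ : Measure (Matrix.unitaryGroup (Fin N) ℂ))

lemma integrable_entryMonomial_mul_conj [IsFiniteMeasure μ] (e j k : Fin t → Fin N) :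
    Integrable (fun U => entryMonomial e j U * (starRingEnd ℂ) (entryMonomial e k U)) μ := by
  refine Integrable.of_bound (C := 1) (Continuous.aestronglyMeasurable ?_)
    (ae_of_all _ fun U => ?_)
  · exact (continuous_entryMonomial e j).mul
      (Complex.continuous_conj.comp (continuous_entryMonomial e k))
  · rw [norm_mul, RCLike.norm_conj]
    exact mul_le_one₀ (norm_entryMonomial_le e j U) (norm_nonneg _) (norm_entryMonomial_le e k U)

lemma entryMoment_eq_zero [μ.IsMulLeftInvariant] (e : Fin t → Fin N) {j k : Fin t → Fin N}
    (h : content k ≠ content j) : entryMoment μ e j k = 0 := by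
  obtain ⟨a, ha⟩ := Finsupp.ne_iff.1 h
  set ζ := Complex.exp (2 * Real.pi * Complex.I / (t + 1 : ℕ))
  have hζ : IsPrimitiveRoot ζ (t + 1) := Complex.isPrimitiveRoot_exp _ t.succ_ne_zero
  have hζ1 : ζ * (starRingEnd ℂ) ζ = 1 := by
    rw [Complex.mul_conj, Complex.normSq_eq_norm_sq, hζ.norm'_eq_one t.succ_ne_zero]
    simp
  let d : Fin N → ℂ := fun b => if b = a then ζ else 1
  have hd : ∀ b, d b * (starRingEnd ℂ) (d b) = 1 := fun b => by
    by_cases hb : b = a <;> simp [d, hb, hζ1]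
  let D : Matrix.unitaryGroup (Fin N) ℂ := ⟨Matrix.diagonal d, by
    rw [Matrix.mem_unitaryGroup_iff, Matrix.star_eq_conjTranspose, Matrix.diagonal_conjTranspose,
      Matrix.diagonal_mul_diagonal, ← Matrix.diagonal_one]
    exact congr_arg _ (funext hd)⟩
  have hD : ∀ (l : Fin t → Fin N) U,
      entryMonomial e l (D * U) = ζ ^ content l a * entryMonomial e l U := fun l U => by
    simp only [entryMonomial, D, Submonoid.coe_mul, Matrix.diagonal_mul, Finset.prod_mul_distrib]
    congr 1
    simp [d, content_apply, Fintype.card_subtype, Finset.prod_ite]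
  have key : entryMoment μ e j k =
      ζ ^ content j a * (starRingEnd ℂ) ζ ^ content k a * entryMoment μ e j k := by
    conv_lhs => rw [entryMoment, ← integral_mul_left_eq_self _ D]
    simp only [hD, map_mul, map_pow]
    rw [entryMoment, ← integral_const_mul]
    congr 1 with U
    ring
  by_contra hne
  have h1 : ζ ^ content j a * (starRingEnd ℂ) ζ ^ content k a = 1 :=
    mul_right_cancel₀ hne (by rw [← key, one_mul])
  refine ha (hζ.pow_inj (Nat.lt_succ_of_le (content_apply_le _ _))
    (Nat.lt_succ_of_le (content_apply_le _ _)) ?_)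
  calc ζ ^ content k a = ζ ^ content k a *
        (ζ ^ content j a * (starRingEnd ℂ) ζ ^ content k a) := by rw [h1, mul_one]
    _ = (ζ * (starRingEnd ℂ) ζ) ^ content k a * ζ ^ content j a := by rw [mul_pow]; ring
    _ = ζ ^ content j a := by rw [hζ1, one_pow, one_mul]

lemma integral_prod_linear_combination [μ.IsMulLeftInvariant] (ht : t ≠ 0) (e : Fin t → Fin N)
    (a : Fin N) (x : Fin N → ℝ) :
    ∫ U, (∏ i, ∑ b, x b * (U : Matrix (Fin N) (Fin N) ℂ) b (e i)) *
        (starRingEnd ℂ) (∏ i, ∑ b, x b * (U : Matrix (Fin N) (Fin N) ℂ) b (e i)) ∂μ =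
      (∑ b, (x b : ℂ) ^ 2) ^ t * entryMoment μ e (fun _ => a) (fun _ => a) := by
  rcases (Finset.sum_nonneg fun b _ => sq_nonneg (x b)).eq_or_lt' with h0 | hpos
  · have hx : ∀ b, x b = 0 := fun b => by
      simpa using (Finset.sum_eq_zero_iff_of_nonneg fun b _ => sq_nonneg (x b)).1 h0 b
        (Finset.mem_univ b)
    simp [hx, ht]
  set r := √(∑ b, x b ^ 2) with hr
  have hr0 : r ≠ 0 := (Real.sqrt_pos.2 hpos).ne'
  have hr2 : r ^ 2 = ∑ b, x b ^ 2 := Real.sq_sqrt hpos.le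
  obtain ⟨V, hV⟩ := exists_unitary_row_eq_s17 a (fun b => x b / r) (by
    simp only [div_pow]
    rw [← Finset.sum_div, ← hr2, div_self (pow_ne_zero 2 hr0)])
  have h (U : Matrix.unitaryGroup (Fin N) ℂ) :
      ∏ i, ∑ b, (x b : ℂ) * (U : Matrix (Fin N) (Fin N) ℂ) b (e i) =
        (r : ℂ) ^ t * entryMonomial e (fun _ => a) (V * U) := by
    have hrt : (r : ℂ) ^ t = ∏ _i : Fin t, (r : ℂ) := by simp
    rw [entryMonomial, hrt, ← Finset.prod_mul_distrib]
    refine Finset.prod_congr rfl fun i _ => ?_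
    rw [Submonoid.coe_mul, Matrix.mul_apply, Finset.mul_sum]
    refine Finset.sum_congr rfl fun b _ => ?_
    have : (r : ℂ) ≠ 0 := by exact_mod_cast hr0
    rw [hV]
    push_cast
    field_simp
  simp only [h, map_mul, map_pow, Complex.conj_ofReal]
  rw [entryMoment, ← integral_mul_left_eq_self (fun U => entryMonomial e (fun _ => a) U *
    (starRingEnd ℂ) (entryMonomial e (fun _ => a) U)) V, ← integral_const_mul]
  congr 1 with U
  have : (∑ b, (x b : ℂ) ^ 2) = (r : ℂ) ^ 2 := by exact_mod_cast hr2.symm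
  rw [this]
  ring

lemma integral_prod_eq_sum_entryMoment [μ.IsMulLeftInvariant] [IsFiniteMeasure μ]
    (e : Fin t → Fin N) (x : Fin N → ℝ) :
    ∫ U, (∏ i, ∑ b, x b * (U : Matrix (Fin N) (Fin N) ℂ) b (e i)) *
        (starRingEnd ℂ) (∏ i, ∑ b, x b * (U : Matrix (Fin N) (Fin N) ℂ) b (e i)) ∂μ =
      ∑ j, (∑ k with content k = content j, entryMoment μ e j k) *
        ∏ i, (x (j i) : ℂ) ^ 2 := by
  have h (U : Matrix.unitaryGroup (Fin N) ℂ) :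
      ∏ i, ∑ b, (x b : ℂ) * (U : Matrix (Fin N) (Fin N) ℂ) b (e i) =
        ∑ j : Fin t → Fin N, (∏ i, (x (j i) : ℂ)) * entryMonomial e j U := by
    simp only [Finset.prod_univ_sum, Fintype.piFinset_univ, entryMonomial,
      Finset.prod_mul_distrib]
  simp only [h, map_sum, map_mul, map_prod, Complex.conj_ofReal, Finset.sum_mul_sum]
  have hm (j k : Fin t → Fin N) (U : Matrix.unitaryGroup (Fin N) ℂ) :
      (∏ i, (x (j i) : ℂ)) * entryMonomial e j U *
        ((∏ i, (x (k i) : ℂ)) * (starRingEnd ℂ) (entryMonomial e k U)) =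
      ((∏ i, (x (j i) : ℂ)) * ∏ i, (x (k i) : ℂ)) *
        (entryMonomial e j U * (starRingEnd ℂ) (entryMonomial e k U)) := by ring
  simp only [hm]
  have hi (j k : Fin t → Fin N) := (integrable_entryMonomial_mul_conj μ e j k).const_mul
    ((∏ i, (x (j i) : ℂ)) * ∏ i, (x (k i) : ℂ))
  rw [integral_finsetSum _ fun j _ => integrable_finsetSum _ fun k _ => hi j k]
  refine Finset.sum_congr rfl fun j _ => ?_
  rw [integral_finsetSum _ fun k _ => hi j k, Finset.sum_filter, Finset.sum_mul]
  refine Finset.sum_congr rfl fun k _ => ?_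
  rw [integral_const_mul]
  change _ * entryMoment μ e j k = _
  split_ifs with hjk
  · obtain ⟨τ, rfl⟩ := exists_perm_of_content_eq hjk.symm
    have := Equiv.prod_comp τ fun i => (x (j i) : ℂ)
    simp only [Function.comp_apply, this, Finset.prod_pow]
    ring
  · rw [entryMoment_eq_zero μ e hjk]
    simp

/-- Summed over the tuples of a given content, the moments of `j` against its rearrangements agree
with the diagonal moment of a constant tuple. -/
lemma sum_entryMoment_sub_eq_zero [μ.IsMulLeftInvariant] [IsFiniteMeasure μ] (ht : t ≠ 0)
    (e : Fin t → Fin N) (a : Fin N) (α : Fin N →₀ ℕ) :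
    ∑ j with content j = α, ((∑ k with content k = content j, entryMoment μ e j k) -
      entryMoment μ e (fun _ => a) (fun _ => a)) = 0 := by
  refine sum_content_fiber_eq_zero (fun j => (∑ k with content k = content j,
    entryMoment μ e j k) - entryMoment μ e (fun _ => a) (fun _ => a)) (fun x => ?_) α
  simp only [sub_mul, Finset.sum_sub_distrib]
  rw [← integral_prod_eq_sum_entryMoment, integral_prod_linear_combination μ ht e a,
    ← Finset.mul_sum, Fintype.sum_pow]
  ring

/-- Averaging over the row permutations of a tuple, summed over all tuples, gives one. -/
lemma sum_sum_entryMoment_comp [IsProbabilityMeasure μ] {e : Fin t → Fin N}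
    (he : Function.Injective e) :
    ∑ j : Fin t → Fin N, ∑ σ : Equiv.Perm (Fin t), entryMoment μ e j (j ∘ σ) = 1 := by
  have h (σ : Equiv.Perm (Fin t)) (U : Matrix.unitaryGroup (Fin N) ℂ) :
      ∑ j : Fin t → Fin N, entryMonomial e j U * (starRingEnd ℂ) (entryMonomial e (j ∘ σ) U) =
        if σ = 1 then 1 else 0 := by
    have hU (a b : Fin N) : ∑ c, (U : Matrix (Fin N) (Fin N) ℂ) c a *
        (starRingEnd ℂ) ((U : Matrix (Fin N) (Fin N) ℂ) c b) = if b = a then 1 else 0 := by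
      have := congr_fun₂ (Matrix.mem_unitaryGroup_iff'.1 U.2) b a
      rw [Matrix.mul_apply, Matrix.one_apply] at this
      rw [← this]
      exact Finset.sum_congr rfl fun c _ => mul_comm _ _
    have hj (j : Fin t → Fin N) :
        entryMonomial e j U * (starRingEnd ℂ) (entryMonomial e (j ∘ σ) U) =
          ∏ i, (U : Matrix (Fin N) (Fin N) ℂ) (j i) (e i) *
            (starRingEnd ℂ) ((U : Matrix (Fin N) (Fin N) ℂ) (j i) (e (σ⁻¹ i))) := by
      rw [entryMonomial, entryMonomial, map_prod, Finset.prod_mul_distrib, ← Equiv.prod_comp σ⁻¹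
        fun i => (starRingEnd ℂ) ((U : Matrix (Fin N) (Fin N) ℂ) ((j ∘ σ) i) (e i))]
      simp
    simp only [hj]
    rw [← Fintype.piFinset_univ, ← Finset.prod_univ_sum (fun _ => Finset.univ)
      fun i c => (U : Matrix (Fin N) (Fin N) ℂ) c (e i) *
            (starRingEnd ℂ) ((U : Matrix (Fin N) (Fin N) ℂ) c (e (σ⁻¹ i)))]
    simp only [hU, he.eq_iff]
    split_ifs with hσ
    · simp [hσ]
    · obtain ⟨i, hi⟩ : ∃ i, σ⁻¹ i ≠ i := by
        by_contra! hc
        exact hσ (inv_eq_one.1 (Equiv.ext hc))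
      exact Finset.prod_eq_zero (Finset.mem_univ i) (if_neg hi)
  rw [Finset.sum_comm]
  have hσ (σ : Equiv.Perm (Fin t)) :
      ∑ j : Fin t → Fin N, entryMoment μ e j (j ∘ σ) = if σ = 1 then 1 else 0 := by
    simp only [entryMoment]
    rw [← integral_finsetSum _ fun j _ => integrable_entryMonomial_mul_conj μ e j _]
    simp [h]
  simp [hσ]

lemma entryMoment_perm_comp [μ.IsMulLeftInvariant] (e j k : Fin t → Fin N)
    (π : Equiv.Perm (Fin N)) : entryMoment μ e (π ∘ j) (π ∘ k) = entryMoment μ e j k := by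
  let P : Matrix.unitaryGroup (Fin N) ℂ := ⟨π.permMatrix ℂ, by
    rw [Matrix.mem_unitaryGroup_iff, Matrix.star_eq_conjTranspose, Matrix.conjTranspose_permMatrix,
      ← Matrix.permMatrix_mul]
    simp⟩
  have hP (l : Fin t → Fin N) (U : Matrix.unitaryGroup (Fin N) ℂ) :
      entryMonomial e l (P * U) = entryMonomial e (π ∘ l) U := by
    simp [entryMonomial, P, Matrix.mul_apply, Equiv.Perm.permMatrix, PEquiv.toMatrix_apply]
  rw [entryMoment, entryMoment, ← integral_mul_left_eq_self (fun U => entryMonomial e j U *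
    (starRingEnd ℂ) (entryMonomial e k U)) P]
  simp only [hP]

/-- For an injective tuple, the moments summed over its permutations equal the diagonal moment
of a constant tuple. -/
lemma sum_entryMoment_comp_of_injective [μ.IsMulLeftInvariant] [IsFiniteMeasure μ] (ht : t ≠ 0)
    (e : Fin t → Fin N) (a : Fin N) {j : Fin t → Fin N} (hj : Function.Injective j) :
    ∑ σ : Equiv.Perm (Fin t), entryMoment μ e j (j ∘ σ) =
      entryMoment μ e (fun _ => a) (fun _ => a) := by
  have h := sum_entryMoment_sub_eq_zero μ ht e a (content j)
  have hc : ∀ k ∈ ({k | content k = content j} : Finset (Fin t → Fin N)),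
      (∑ l with content l = content k, entryMoment μ e k l) -
        entryMoment μ e (fun _ => a) (fun _ => a) =
      (∑ σ : Equiv.Perm (Fin t), entryMoment μ e j (j ∘ σ)) -
        entryMoment μ e (fun _ => a) (fun _ => a) := fun k hk => by
    obtain ⟨τ, rfl⟩ := exists_perm_of_content_eq (Finset.mem_filter.1 hk).2.symm
    have h1 := sum_perm_comp (j ∘ τ) (entryMoment μ e (j ∘ τ))
    rw [contentFactorial_of_injective (hj.comp τ.injective), Nat.cast_one, one_mul] at h1
    rw [← h1]
    congr 1
    have hπ : τ.viaFintypeEmbedding ⟨j, hj⟩ ∘ j = j ∘ τ := funext fun i =>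
      τ.viaFintypeEmbedding_apply_image ⟨j, hj⟩ i
    refine Finset.sum_congr rfl fun σ _ => ?_
    rw [← hπ, Function.comp_assoc, entryMoment_perm_comp]
  rw [Finset.sum_congr rfl hc, Finset.sum_const, smul_eq_zero, sub_eq_zero] at h
  exact h.resolve_left (Finset.card_ne_zero_of_mem (a := j) (by simp))

lemma entryMoment_const [μ.IsMulLeftInvariant] [IsProbabilityMeasure μ] (ht : t ≠ 0)
    {e : Fin t → Fin N} (he : Function.Injective e) (a : Fin N) :
    entryMoment μ e (fun _ => a) (fun _ => a) = 1 / ∏ s ∈ Finset.range t, ((N : ℂ) + s) := by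
  set c := entryMoment μ e (fun _ => a) (fun _ => a)
  have h0 : ∑ j : Fin t → Fin N, (contentFactorial j : ℂ) *
      ((∑ k with content k = content j, entryMoment μ e j k) - c) = 0 := by
    rw [← Finset.sum_fiberwise_of_maps_to (t := Finset.univ.image content)
      fun j _ => Finset.mem_image_of_mem _ (Finset.mem_univ j)]
    refine Finset.sum_eq_zero fun α _ => ?_
    have hα : ∀ j ∈ ({j | content j = α} : Finset (Fin t → Fin N)),
        (contentFactorial j : ℂ) *
          ((∑ k with content k = content j, entryMoment μ e j k) - c) =
        ((∏ b, (α b)! : ℕ) : ℂ) *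
          ((∑ k with content k = content j, entryMoment μ e j k) - c) := fun j hj => by
      rw [contentFactorial, (Finset.mem_filter.1 hj).2]
    rw [Finset.sum_congr rfl hα, ← Finset.mul_sum, sum_entryMoment_sub_eq_zero μ ht e a, mul_zero]
  simp only [mul_sub, Finset.sum_sub_distrib, ← sum_perm_comp] at h0
  rw [sum_sum_entryMoment_comp μ he, ← Finset.sum_mul, ← Nat.cast_sum, sum_contentFactorial,
    sub_eq_zero] at h0
  push_cast at h0
  exact eq_one_div_of_mul_eq_one_right h0.symm

end Moments

theorem weingarten_sum (N t : ℕ) (ht1 : 1 ≤ t) (ht : t ≤ N)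
    [MeasurableSpace (Matrix.unitaryGroup (Fin N) ℂ)]
    [BorelSpace (Matrix.unitaryGroup (Fin N) ℂ)]
    (μ : Measure (Matrix.unitaryGroup (Fin N) ℂ))
    [μ.IsHaarMeasure] [IsProbabilityMeasure μ] :
    ∑ σ : Equiv.Perm (Fin t), weingarten N t ht μ σ =
      1 / ∏ j ∈ Finset.range t, ((N : ℂ) + j) := by
  have he : Function.Injective (Fin.castLE ht) := Fin.castLE_injective ht
  have ht0 : t ≠ 0 := Nat.one_le_iff_ne_zero.1 ht1
  have hw (σ : Equiv.Perm (Fin t)) :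
      weingarten N t ht μ σ⁻¹ = entryMoment μ (Fin.castLE ht) (Fin.castLE ht)
        (Fin.castLE ht ∘ σ) := by
    simp only [weingarten, entryMoment, entryMonomial, map_prod]
    congr 1 with U
    congr 1
    rw [← Equiv.prod_comp σ]
    simp
  rw [← Equiv.sum_comp (Equiv.inv (Equiv.Perm (Fin t)))]
  simp only [Equiv.inv_apply, hw]
  rw [sum_entryMoment_comp_of_injective μ ht0 _ ⟨0, by lia⟩ he, entryMoment_const μ ht0 he]
end
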